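/- For every positive integer n, the complete graph K_n on n vertices is NIC-planar if and only if n ≤ 5. -/

import Mathlib

open Set

/-- Two subsets of the plane *properly cross* at a point `p`: in some open
neighbourhood of `p` the pair of sets looks, up to homeomorphism, like the two
coordinate axes meeting at the origin. -/
def ProperCross (A₁ A₂ : Set (ℝ × ℝ)) (p : ℝ × ℝ) : Prop :=
  ∃ U : Set (ℝ × ℝ), IsOpen U ∧ ∃ hp : p ∈ U, ∃ φ : U ≃ₜ (ℝ × ℝ),
    φ ⟨p, hp⟩ = (0, 0) ∧
    (fun x => φ x) '' {x : U | (x : ℝ × ℝ) ∈ A₁} = {q : ℝ × ℝ | q.2 = 0} ∧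
    (fun x => φ x) '' {x : U | (x : ℝ × ℝ) ∈ A₂} = {q : ℝ × ℝ | q.1 = 0}

/-- A drawing of a simple graph `G` in the plane: vertices go to distinct points,
each edge is drawn as a continuous injective arc joining the points of its two
endpoints, no arc passes through the point of a vertex other than its endpoints,
arcs of edges sharing an endpoint meet only at that common point, any two arcs
meet in finitely many points, every intersection point of two arcs that is not a
common endpoint is a proper crossing, and no point of the plane that is not a
vertex point lies on more than two arcs. -/
structure Drawing {V : Type*} (G : SimpleGraph V) where
  pos : V → ℝ × ℝ
  pos_inj : Function.Injective pos
  arc : G.edgeSet → ℝ → ℝ × ℝ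
  arc_cont : ∀ e, ContinuousOn (arc e) (Icc 0 1)
  arc_inj : ∀ e, InjOn (arc e) (Icc 0 1)
  arc_ends : ∀ e : G.edgeSet, ∃ u v : V, (e : Sym2 V) = s(u, v) ∧
    arc e 0 = pos u ∧ arc e 1 = pos v
  no_vertex_interior : ∀ (e : G.edgeSet) (v : V), v ∉ (e : Sym2 V) →
    pos v ∉ arc e '' Icc 0 1
  shared_endpoint : ∀ e₁ e₂ : G.edgeSet, e₁ ≠ e₂ → ∀ v : V,
    v ∈ (e₁ : Sym2 V) → v ∈ (e₂ : Sym2 V) →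
    arc e₁ '' Icc 0 1 ∩ arc e₂ '' Icc 0 1 ⊆ {pos v}
  finite_meet : ∀ e₁ e₂ : G.edgeSet, e₁ ≠ e₂ →
    (arc e₁ '' Icc 0 1 ∩ arc e₂ '' Icc 0 1).Finite
  proper : ∀ e₁ e₂ : G.edgeSet, e₁ ≠ e₂ →
    ∀ p ∈ arc e₁ '' Icc 0 1 ∩ arc e₂ '' Icc 0 1, p ∉ Set.range pos →
    ProperCross (arc e₁ '' Icc 0 1) (arc e₂ '' Icc 0 1) p
  at_most_two : ∀ p : ℝ × ℝ, p ∉ Set.range pos →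
    ∀ e₁ e₂ e₃ : G.edgeSet, p ∈ arc e₁ '' Icc 0 1 → p ∈ arc e₂ '' Icc 0 1 →
      p ∈ arc e₃ '' Icc 0 1 → e₁ = e₂ ∨ e₁ = e₃ ∨ e₂ = e₃

namespace Drawing

variable {V : Type*} {G : SimpleGraph V}

/-- The image of the arc drawn for the edge `e`. -/
def arcIm (D : Drawing G) (e : G.edgeSet) : Set (ℝ × ℝ) :=
  D.arc e '' Icc 0 1

/-- The set of crossings of the drawing: points that are not vertex points and
lie on (at least, hence exactly) two arcs.  (An intersection point of two arcs
that is a common endpoint of the two edges is a vertex point, and conversely a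
vertex point on two arcs is a common endpoint, so these are precisely the
intersection points of pairs of arcs that are not common endpoints.) -/
def crossings (D : Drawing G) : Set (ℝ × ℝ) :=
  {p | p ∉ Set.range D.pos ∧ ∃ e₁ e₂ : G.edgeSet, e₁ ≠ e₂ ∧ p ∈ D.arcIm e₁ ∧ p ∈ D.arcIm e₂}

/-- The number of crossings of the drawing. -/
noncomputable def crossingCount (D : Drawing G) : ℕ := D.crossings.ncard

/-- The cluster set `S(c)` of a crossing `c`: the set of end-vertices of the
(two) edges whose arcs pass through `c`. -/
def cluster (D : Drawing G) (c : ℝ × ℝ) : Set V :=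
  {v | ∃ e : G.edgeSet, c ∈ D.arcIm e ∧ v ∈ (e : Sym2 V)}

/-- A drawing is 1-planar if each edge's arc is crossed at most once. -/
def IsOnePlanar (D : Drawing G) : Prop :=
  ∀ e : G.edgeSet, {p | p ∈ D.crossings ∧ p ∈ D.arcIm e}.Subsingleton

/-- A drawing is NIC-planar if it is 1-planar and the cluster sets of any two
distinct crossings share at most one vertex. -/
def IsNICPlanar (D : Drawing G) : Prop :=
  D.IsOnePlanar ∧ ∀ c₁ ∈ D.crossings, ∀ c₂ ∈ D.crossings, c₁ ≠ c₂ →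
    (D.cluster c₁ ∩ D.cluster c₂).ncard ≤ 1

/-- A drawing is IC-planar if it is 1-planar and the cluster sets of any two
distinct crossings are disjoint. -/
def IsICPlanar (D : Drawing G) : Prop :=
  D.IsOnePlanar ∧ ∀ c₁ ∈ D.crossings, ∀ c₂ ∈ D.crossings, c₁ ≠ c₂ →
    D.cluster c₁ ∩ D.cluster c₂ = ∅

end Drawing

/-- A graph is 1-planar if it admits a 1-planar drawing. -/
def SimpleGraph.OnePlanar {V : Type*} (G : SimpleGraph V) : Prop :=
  ∃ D : Drawing G, D.IsOnePlanar

/-- A graph is NIC-planar if it admits an NIC-planar drawing. -/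
def SimpleGraph.NICPlanar {V : Type*} (G : SimpleGraph V) : Prop :=
  ∃ D : Drawing G, D.IsNICPlanar

/-- A graph is IC-planar if it admits an IC-planar drawing. -/
def SimpleGraph.ICPlanar {V : Type*} (G : SimpleGraph V) : Prop :=
  ∃ D : Drawing G, D.IsICPlanar

/-- The crossing number of `G`: the minimum number of crossings over all
drawings of `G`. -/
noncomputable def SimpleGraph.crossingNumber {V : Type*} (G : SimpleGraph V) : ℕ :=
  sInf {n | ∃ D : Drawing G, D.crossingCount = n}
/-- The graph `H` is a minimum non-NIC-planar graph: `H` is not NIC-planar but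
deleting any single edge of `H` yields an NIC-planar graph. -/
def MinNonNICPlanar {V : Type*} (H : SimpleGraph V) : Prop :=
  ¬ H.NICPlanar ∧ ∀ e ∈ H.edgeSet, (H.deleteEdges {e}).NICPlanar

/-- The graph `H` is a minimum non-IC-planar graph: `H` is not IC-planar but
deleting any single edge of `H` yields an IC-planar graph. -/
def MinNonICPlanar {V : Type*} (H : SimpleGraph V) : Prop :=
  ¬ H.ICPlanar ∧ ∀ e ∈ H.edgeSet, (H.deleteEdges {e}).ICPlanar

/-- The complete multipartite graph with parts of sizes `a 0, …, a (k-1)`. -/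
abbrev completeMultipartite {k : ℕ} (a : Fin k → ℕ) :
    SimpleGraph (Σ i : Fin k, Fin (a i)) :=
  SimpleGraph.completeMultipartiteGraph fun i => Fin (a i)

/-- `G` contains a subgraph isomorphic to `H`, i.e. there is an injective graph
homomorphism from `H` to `G`. -/
def ContainsSubgraphIso {V W : Type*} (G : SimpleGraph V) (H : SimpleGraph W) : Prop :=
  ∃ f : H →g G, Function.Injective f

open scoped unitInterval

/-- A continuous nowhere vanishing complex function on the unit square has a continuous
logarithm. -/
theorem exists_continuous_log_square (F : C(I × I, ℂ)) (hF : ∀ x, F x ≠ 0) :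
    ∃ L : C(I × I, ℂ), ∀ x, Complex.exp (L x) = F x := by
  have : ContractibleSpace I :=
    (convex_Icc (0 : ℝ) 1).contractibleSpace ⟨0, by simp⟩
  have : LocallyPathConnectedSpace I := (convex_Icc (0 : ℝ) 1).locallyPathConnectedSpace
  obtain ⟨L, ⟨-, hL⟩, -⟩ := Complex.isCoveringMapOn_exp.existsUnique_continuousMap_lifts F
    (a₀ := (0, 0)) (Complex.exp_log (hF (0, 0))) hF
  exact ⟨L, congrFun hL⟩

/-- Two continuous logarithms along a path of functions that differ by a constant factor have the
same increment. -/
theorem log_increment_unique {L L' : I → ℂ} (hL : Continuous L) (hL' : Continuous L') (c : ℂ)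
    (h : ∀ t, Complex.exp (L t) = c * Complex.exp (L' t)) : L 1 - L 0 = L' 1 - L' 0 := by
  have key := Complex.isCoveringMap_exp.const_of_comp (g := fun t : I => L t - L' t)
    (hL.sub hL') (fun a a' => by
      simp only [Subtype.mk.injEq, Complex.exp_sub, h]
      rw [mul_div_cancel_right₀ _ (Complex.exp_ne_zero _),
        mul_div_cancel_right₀ _ (Complex.exp_ne_zero _)]) 1 0
  linear_combination key

/-- The integer cocycle of direction changes attached to a planar drawing: `n v x y` counts the
turns of the direction from `p v` to a point moving along the edge from `p x` to `p y`, and the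
relation comes from the square of directions between the points of two disjoint edges. -/
theorem exists_turning_numbers {m : ℕ} (p : Fin m → ℂ) (hp : Function.Injective p)
    (γ : ∀ i j, Path (p i) (p j))
    (hv : ∀ v x y, x < y → v ≠ x → v ≠ y → ∀ t, γ x y t ≠ p v)
    (hd : ∀ u v x y, u < v → x < y → u ≠ x → u ≠ y → v ≠ x → v ≠ y →
      ∀ s t, γ u v s ≠ γ x y t) :
    ∃ n : Fin m → Fin m → Fin m → ℤ, ∀ u v x y, u < v → x < y → u ≠ x → u ≠ y → v ≠ x → v ≠ y →
      2 * (n u x y + n y u v - n x u v - n v x y) =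
        (if u < x then -1 else 1) + (if v < y then -1 else 1)
          - (if u < y then -1 else 1) - (if v < x then -1 else 1) := by
  classical
  have hpi : (Real.pi : ℂ) * Complex.I ≠ 0 := by simp [Real.pi_ne_zero]
  let l : Fin m → Fin m → ℂ := fun i j =>
    if i < j then Complex.log (p j - p i) else Complex.log (p i - p j) + Real.pi * Complex.I
  have hl : ∀ i j, i ≠ j → Complex.exp (l i j) = p j - p i := by
    intro i j hij
    have h1 : p j - p i ≠ 0 := sub_ne_zero.2 fun h => hij (hp h).symm
    have h2 : p i - p j ≠ 0 := sub_ne_zero.2 fun h => hij (hp h)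
    by_cases h : i < j
    · simp [l, h, Complex.exp_log h1]
    · simp [l, h, Complex.exp_add, Complex.exp_log h2]
  have hanti : ∀ i j, i ≠ j → l i j - l j i =
      ((if i < j then -1 else 1 : ℤ) : ℂ) * (Real.pi * Complex.I) := by
    intro i j hij
    rcases lt_or_gt_of_ne hij with h | h
    · simp [l, h, h.not_gt]
    · simp [l, h, h.not_gt]
  have hlift : ∀ v x y, x < y → v ≠ x → v ≠ y → ∃ Λ : I → ℂ, Continuous Λ ∧
      (∀ t, Complex.exp (Λ t) = γ x y t - p v) := by
    intro v x y hxy hx hy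
    obtain ⟨L, hL⟩ := exists_continuous_log_square
      ⟨fun q => γ x y q.1 - p v, by fun_prop⟩ (fun q => sub_ne_zero.2 (hv v x y hxy hx hy q.1))
    exact ⟨fun t => L (t, 0), by fun_prop, fun t => hL (t, 0)⟩
  have hn : ∀ v x y, ∃ n : ℤ, x < y → v ≠ x → v ≠ y → ∀ (Λ : I → ℂ) (c : ℂ), Continuous Λ →
      (∀ t, Complex.exp (Λ t) = c * (γ x y t - p v)) →
        Λ 1 - Λ 0 = l v y - l v x + n * (2 * Real.pi * Complex.I) := by
    intro v x y
    by_cases h : x < y ∧ v ≠ x ∧ v ≠ y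
    swap
    · exact ⟨0, fun h1 h2 h3 => (h ⟨h1, h2, h3⟩).elim⟩
    obtain ⟨hxy, hx, hy⟩ := h
    obtain ⟨Λ₀, hc, hΛ⟩ := hlift v x y hxy hx hy
    have h0 : Complex.exp (Λ₀ 0) = Complex.exp (l v x) := by simp [hΛ, hl v x hx]
    have h1 : Complex.exp (Λ₀ 1) = Complex.exp (l v y) := by simp [hΛ, hl v y hy]
    obtain ⟨a, ha⟩ := Complex.exp_eq_exp_iff_exists_int.1 h0
    obtain ⟨b, hb⟩ := Complex.exp_eq_exp_iff_exists_int.1 h1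
    refine ⟨b - a, fun _ _ _ Λ c hcont hexp => ?_⟩
    rw [log_increment_unique hcont hc c (fun t => by rw [hexp, hΛ]), ha, hb]
    push_cast
    ring
  choose n hn using hn
  refine ⟨n, fun u v x y huv hxy hux huy hvx hvy => ?_⟩
  obtain ⟨L, hL⟩ := exists_continuous_log_square
    ⟨fun q => γ x y q.2 - γ u v q.1, by fun_prop⟩
    (fun q => sub_ne_zero.2 (hd u v x y huv hxy hux huy hvx hvy q.1 q.2).symm)
  have e1 := hn u x y hxy hux huy (fun t => L (0, t)) 1 (by fun_prop) (fun t => by simp [hL])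
  have e2 := hn v x y hxy hvx hvy (fun t => L (1, t)) 1 (by fun_prop) (fun t => by simp [hL])
  have e3 := hn x u v huv hux.symm hvx.symm (fun t => L (t, 0)) (-1) (by fun_prop)
    (fun t => by simp [hL])
  have e4 := hn y u v huv huy.symm hvy.symm (fun t => L (t, 1)) (-1) (by fun_prop)
    (fun t => by simp [hL])
  have a1 := hanti u x hux
  have a2 := hanti v y hvy
  have a3 := hanti u y huy
  have a4 := hanti v x hvx
  have key : ((2 * (n u x y + n y u v - n x u v - n v x y) : ℤ) : ℂ) * (Real.pi * Complex.I) =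
      (((if u < x then -1 else 1) + (if v < y then -1 else 1)
          - (if u < y then -1 else 1) - (if v < x then -1 else 1) : ℤ) : ℂ) *
        (Real.pi * Complex.I) := by
    rw [Int.cast_sub, Int.cast_sub, Int.cast_add, sub_mul, sub_mul, add_mul, ← a1, ← a2, ← a3,
      ← a4]
    push_cast
    linear_combination -e1 - e4 + e3 + e2
  exact_mod_cast mul_right_cancel₀ hpi key

/-- `K₅` cannot be drawn in the plane with pairwise disjoint arcs for disjoint edges. -/
theorem not_exists_planar_drawing_five (p : Fin 5 → ℂ) (hp : Function.Injective p)
    (γ : ∀ i j, Path (p i) (p j))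
    (hv : ∀ v x y, x < y → v ≠ x → v ≠ y → ∀ t, γ x y t ≠ p v)
    (hd : ∀ u v x y, u < v → x < y → u ≠ x → u ≠ y → v ≠ x → v ≠ y →
      ∀ s t, γ u v s ≠ γ x y t) : False := by
  obtain ⟨n, hn⟩ := exists_turning_numbers p hp γ hv hd
  have h1 := hn 0 1 2 3 (by decide) (by decide) (by decide) (by decide) (by decide) (by decide)
  have h2 := hn 0 1 2 4 (by decide) (by decide) (by decide) (by decide) (by decide) (by decide)
  have h3 := hn 0 1 3 4 (by decide) (by decide) (by decide) (by decide) (by decide) (by decide)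
  have h4 := hn 0 2 1 3 (by decide) (by decide) (by decide) (by decide) (by decide) (by decide)
  have h5 := hn 0 2 1 4 (by decide) (by decide) (by decide) (by decide) (by decide) (by decide)
  have h6 := hn 0 2 3 4 (by decide) (by decide) (by decide) (by decide) (by decide) (by decide)
  have h7 := hn 0 3 1 2 (by decide) (by decide) (by decide) (by decide) (by decide) (by decide)
  have h8 := hn 0 3 1 4 (by decide) (by decide) (by decide) (by decide) (by decide) (by decide)
  have h9 := hn 0 3 2 4 (by decide) (by decide) (by decide) (by decide) (by decide) (by decide)
  have h10 := hn 0 4 1 2 (by decide) (by decide) (by decide) (by decide) (by decide) (by decide)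
  have h11 := hn 0 4 1 3 (by decide) (by decide) (by decide) (by decide) (by decide) (by decide)
  have h12 := hn 0 4 2 3 (by decide) (by decide) (by decide) (by decide) (by decide) (by decide)
  have h13 := hn 1 2 3 4 (by decide) (by decide) (by decide) (by decide) (by decide) (by decide)
  have h14 := hn 1 3 2 4 (by decide) (by decide) (by decide) (by decide) (by decide) (by decide)
  have h15 := hn 1 4 2 3 (by decide) (by decide) (by decide) (by decide) (by decide) (by decide)
  simp +decide only [if_true, if_false] at h1 h2 h3 h4 h5 h6 h7 h8 h9 h10 h11 h12 h13 h14 h15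
  omega

namespace Drawing

/-- The arc drawn for the edge joining `u` and `v`, oriented from `u` to `v`. -/
theorem exists_path {V : Type*} (D : Drawing (⊤ : SimpleGraph V)) {u v : V} (h : u ≠ v) :
    ∃ γ : Path (Complex.equivRealProdCLM.symm (D.pos u)) (Complex.equivRealProdCLM.symm (D.pos v)),
      ∀ t, Complex.equivRealProdCLM (γ t) ∈ D.arcIm ⟨s(u, v), by simpa using h⟩ := by
  set e : (⊤ : SimpleGraph V).edgeSet := ⟨s(u, v), by simpa using h⟩
  obtain ⟨a, b, hab, h0, h1⟩ := D.arc_ends e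
  let γ : Path (Complex.equivRealProdCLM.symm (D.pos a))
      (Complex.equivRealProdCLM.symm (D.pos b)) :=
    { toFun := fun t => Complex.equivRealProdCLM.symm (D.arc e t)
      continuous_toFun := by
        have := (D.arc_cont e).domRestrict
        exact Complex.equivRealProdCLM.symm.continuous.comp this
      source' := by simp [h0]
      target' := by simp [h1] }
  have hγ : ∀ t, Complex.equivRealProdCLM (γ t) ∈ D.arcIm e := fun t =>
    ⟨t, t.2, by simp [γ]⟩
  rcases Sym2.eq_iff.1 hab with ⟨rfl, rfl⟩ | ⟨rfl, rfl⟩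
  · exact ⟨γ, hγ⟩
  · exact ⟨γ.symm, fun t => hγ _⟩

/-- In a drawing of a complete graph, among any five vertices there are two disjoint edges whose
arcs meet. -/
theorem exists_arcs_meet {V : Type*} (D : Drawing (⊤ : SimpleGraph V)) (f : Fin 5 → V)
    (hf : Function.Injective f) :
    ∃ u v x y : Fin 5, ∃ (huv : u ≠ v) (hxy : x ≠ y), u ≠ x ∧ u ≠ y ∧ v ≠ x ∧ v ≠ y ∧
      ∃ c, c ∈ D.arcIm ⟨s(f u, f v), by simpa using hf.ne huv⟩ ∧
        c ∈ D.arcIm ⟨s(f x, f y), by simpa using hf.ne hxy⟩ := by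
  by_contra! H
  have hγ : ∀ i j, ∃ γ : Path (Complex.equivRealProdCLM.symm (D.pos (f i)))
      (Complex.equivRealProdCLM.symm (D.pos (f j))), ∀ h : i ≠ j,
      ∀ t, Complex.equivRealProdCLM (γ t) ∈ D.arcIm ⟨s(f i, f j), by simpa using hf.ne h⟩ := by
    intro i j
    by_cases h : i = j
    · subst h
      exact ⟨Path.refl _, fun h => (h rfl).elim⟩
    · obtain ⟨γ, hγ⟩ := D.exists_path (hf.ne h)
      exact ⟨γ, fun _ => hγ⟩
  choose γ hγ using hγ
  refine not_exists_planar_drawing_five (fun i => Complex.equivRealProdCLM.symm (D.pos (f i)))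
    (Complex.equivRealProdCLM.symm.injective.comp (D.pos_inj.comp hf)) γ ?_ ?_
  · intro v x y hxy hx hy t h
    refine D.no_vertex_interior ⟨s(f x, f y), by simpa using hf.ne hxy.ne⟩ (f v)
      (by simp [hf.eq_iff, hx, hy]) ?_
    have := hγ x y hxy.ne t
    rw [h] at this
    simpa [arcIm] using this
  · intro u v x y huv hxy hux huy hvx hvy s t h
    refine H u v x y huv.ne hxy.ne hux huy hvx hvy _ (hγ u v huv.ne s) ?_
    rw [h]
    exact hγ x y hxy.ne t

/-- A common point of the arcs of two disjoint edges is a crossing. -/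
theorem mem_crossings_of_disjoint {V : Type*} {G : SimpleGraph V} (D : Drawing G)
    {e₁ e₂ : G.edgeSet} (h : ∀ v, v ∈ (e₁ : Sym2 V) → v ∉ (e₂ : Sym2 V)) {c : ℝ × ℝ}
    (h₁ : c ∈ D.arcIm e₁) (h₂ : c ∈ D.arcIm e₂) : c ∈ D.crossings := by
  refine ⟨?_, e₁, e₂, ?_, h₁, h₂⟩
  · rintro ⟨v, rfl⟩
    have h3 : v ∈ (e₁ : Sym2 V) := by
      by_contra hv
      exact D.no_vertex_interior e₁ v hv h₁
    have h4 : v ∈ (e₂ : Sym2 V) := by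
      by_contra hv
      exact D.no_vertex_interior e₂ v hv h₂
    exact h v h3 h4
  · rintro rfl
    obtain ⟨⟨a, b⟩, he⟩ := e₁
    exact h a (by simp) (by simp)

end Drawing

/-- A complete graph on at least six vertices is not NIC-planar. -/
theorem not_nicPlanar_top {n : ℕ} (hn : 6 ≤ n) : ¬ (⊤ : SimpleGraph (Fin n)).NICPlanar := by
  classical
  rintro ⟨D, -, hD⟩
  let g : Fin 6 → Fin n := Fin.castLE hn
  have hg : Function.Injective g := Fin.castLE_injective hn
  obtain ⟨i, j, k, l, hij, hkl, hik, hil, hjk, hjl, c, hc₁, hc₂⟩ :=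
    D.exists_arcs_meet (g ∘ Fin.castSucc) (hg.comp (Fin.castSucc_injective 5))
  set i' := i.castSucc
  have hs : Function.Injective (g ∘ i'.succAbove) := hg.comp Fin.succAbove_right_injective
  obtain ⟨u, v, x, y, huv, hxy, hux, huy, hvx, hvy, d, hd₁, hd₂⟩ := D.exists_arcs_meet _ hs
  have hcs := hg.comp (Fin.castSucc_injective 5)
  have hc : c ∈ D.crossings := D.mem_crossings_of_disjoint (by
    simp [hcs.eq_iff, -Function.comp_apply, hik, hil, hjk, hjl]) hc₁ hc₂
  have hd : d ∈ D.crossings := D.mem_crossings_of_disjoint (by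
    simp [hs.eq_iff, -Function.comp_apply, hux, huy, hvx, hvy]) hd₁ hd₂
  have hne : ∀ a, (g ∘ Fin.castSucc) i ≠ (g ∘ i'.succAbove) a := fun a h =>
    Fin.succAbove_ne i' a (hg h).symm
  by_cases hcd : c = d
  · subst hcd
    have key := D.at_most_two c hc.1 _ _ _ hc₁ hd₁ hd₂
    simp only [Subtype.mk.injEq, Sym2.eq_iff, hs.eq_iff] at key
    have := hne u
    have := hne v
    have := hne x
    have := hne y
    tauto
  · have h := hD c hc d hd hcd
    let A : Finset (Fin 6) := Finset.image Fin.castSucc {i, j, k, l}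
    let B : Finset (Fin 6) := Finset.image i'.succAbove {u, v, x, y}
    have hA : A.card = 4 := by
      rw [Finset.card_image_of_injective _ (Fin.castSucc_injective 5)]
      simp [*]
    have hB : B.card = 4 := by
      rw [Finset.card_image_of_injective _ Fin.succAbove_right_injective]
      simp [*]
    have h1 : (A ∪ B).card ≤ 6 := by simpa using Finset.card_le_univ (A ∪ B)
    have h2 := Finset.card_union_add_card_inter A B
    have hAc : ∀ z ∈ A, g z ∈ D.cluster c := by
      intro z hz
      simp only [A, Finset.mem_image, Finset.mem_insert, Finset.mem_singleton] at hz
      obtain ⟨w, hw, rfl⟩ := hz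
      rcases hw with rfl | rfl | rfl | rfl
      · exact ⟨_, hc₁, by simp⟩
      · exact ⟨_, hc₁, by simp⟩
      · exact ⟨_, hc₂, by simp⟩
      · exact ⟨_, hc₂, by simp⟩
    have hBd : ∀ z ∈ B, g z ∈ D.cluster d := by
      intro z hz
      simp only [B, Finset.mem_image, Finset.mem_insert, Finset.mem_singleton] at hz
      obtain ⟨w, hw, rfl⟩ := hz
      rcases hw with rfl | rfl | rfl | rfl
      · exact ⟨_, hd₁, by simp⟩
      · exact ⟨_, hd₁, by simp⟩
      · exact ⟨_, hd₂, by simp⟩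
      · exact ⟨_, hd₂, by simp⟩
    have h3 : (((A ∩ B).image g : Finset (Fin n)) : Set (Fin n)) ⊆
        D.cluster c ∩ D.cluster d := by
      intro z hz
      simp only [Finset.coe_image, Set.mem_image, Finset.mem_coe, Finset.mem_inter] at hz
      obtain ⟨w, ⟨hwA, hwB⟩, rfl⟩ := hz
      exact ⟨hAc w hwA, hBd w hwB⟩
    have h4 := Set.ncard_le_ncard h3 (Set.toFinite _)
    rw [Set.ncard_coe_finset, Finset.card_image_of_injective _ hg] at h4
    omega

/-- Twice the signed area of the triangle `P Q R`. -/
def signedArea {R : Type*} [Sub R] [Mul R] (P Q S : R × R) : R :=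
  (Q.1 - P.1) * (S.2 - P.2) - (Q.2 - P.2) * (S.1 - P.1)

theorem signedArea_lineMap (P Q A B : ℝ × ℝ) (t : ℝ) :
    signedArea P Q (AffineMap.lineMap A B t) =
      (1 - t) * signedArea P Q A + t * signedArea P Q B := by
  simp only [signedArea, AffineMap.lineMap_apply, vsub_eq_sub, vadd_eq_add, Prod.fst_add,
    Prod.snd_add, Prod.smul_fst, Prod.smul_snd, Prod.fst_sub, Prod.snd_sub, smul_eq_mul]
  ring

theorem signedArea_eq_zero_of_mem_segment {P Q X : ℝ × ℝ} (h : X ∈ segment ℝ P Q) :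
    signedArea P Q X = 0 := by
  rw [segment_eq_image_lineMap] at h
  obtain ⟨t, -, rfl⟩ := h
  rw [signedArea_lineMap]
  simp only [signedArea]
  ring

theorem eq_of_mem_segment_of_signedArea_ne_zero {P Q R X : ℝ × ℝ} (h : signedArea P Q R ≠ 0)
    (h₁ : X ∈ segment ℝ P Q) (h₂ : X ∈ segment ℝ P R) : X = P := by
  have h0 := signedArea_eq_zero_of_mem_segment h₁
  rw [segment_eq_image_lineMap] at h₂
  obtain ⟨t, -, rfl⟩ := h₂
  rw [signedArea_lineMap] at h0
  have h3 : signedArea P Q P = 0 := by simp only [signedArea]; ring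
  have h4 : t = 0 := by simpa [h3, h] using h0
  simp [h4]

theorem not_mem_segment_of_signedArea_mul_pos {P Q A B X : ℝ × ℝ}
    (h : 0 < signedArea P Q A * signedArea P Q B) (h₁ : X ∈ segment ℝ P Q) :
    X ∉ segment ℝ A B := by
  intro h₂
  have h0 := signedArea_eq_zero_of_mem_segment h₁
  rw [segment_eq_image_lineMap] at h₂
  obtain ⟨t, ⟨ht0, ht1⟩, rfl⟩ := h₂
  rw [signedArea_lineMap] at h0
  rcases pos_and_pos_or_neg_and_neg_of_mul_pos h with ⟨ha, hb⟩ | ⟨ha, hb⟩ <;>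
  rcases ht0.eq_or_lt with rfl | ht
  · simp at h0; linarith
  · nlinarith [mul_pos ht hb, mul_nonneg (sub_nonneg.2 ht1) ha.le]
  · simp at h0; linarith
  · nlinarith [mul_neg_of_pos_of_neg ht hb, mul_nonpos_of_nonneg_of_nonpos (sub_nonneg.2 ht1) ha.le]

theorem ProperCross.symm {A B : Set (ℝ × ℝ)} {p : ℝ × ℝ} (h : ProperCross A B p) :
    ProperCross B A p := by
  obtain ⟨U, hU, hp, φ, h0, h1, h2⟩ := h
  refine ⟨U, hU, hp, φ.trans (Homeomorph.prodComm ℝ ℝ), by simp [h0], ?_, ?_⟩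
  · have := congrArg (Prod.swap '' ·) h2
    simp only [image_image] at this
    simpa using this.trans (by ext ⟨a, b⟩; simp [eq_comm])
  · have := congrArg (Prod.swap '' ·) h1
    simp only [image_image] at this
    simpa using this.trans (by ext ⟨a, b⟩; simp [eq_comm])

/-- A horizontal and a vertical segment through the origin cross properly there. -/
theorem properCross_axes {a b c d : ℝ} (ha : a ≤ -(Real.pi / 2)) (hb : Real.pi / 2 ≤ b)
    (hc : c ≤ -(Real.pi / 2)) (hd : Real.pi / 2 ≤ d) :
    ProperCross (segment ℝ (a, 0) (b, 0)) (segment ℝ (0, c) (0, d)) (0, 0) := by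
  have hpi := Real.pi_pos
  have h0 : (0 : ℝ) ∈ Ioo (-(Real.pi / 2)) (Real.pi / 2) := by constructor <;> linarith
  let T := Real.tanOrderIso.toHomeomorph
  have hT0 : T ⟨0, h0⟩ = 0 := by
    change Real.tan 0 = 0
    simp
  have hT : ∀ x, T x = 0 ↔ (x : ℝ) = 0 := fun x => by
    rw [show T x = 0 ↔ T x = T ⟨0, h0⟩ by rw [hT0], T.injective.eq_iff, Subtype.ext_iff]
  refine ⟨Ioo (-(Real.pi / 2)) (Real.pi / 2) ×ˢ Ioo (-(Real.pi / 2)) (Real.pi / 2),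
    isOpen_Ioo.prod isOpen_Ioo, ⟨h0, h0⟩,
    (Homeomorph.Set.prod _ _).trans (T.prodCongr T), ?_, ?_, ?_⟩
  · exact Prod.ext hT0 hT0
  · rw [← Prod.image_mk_segment_left, segment_eq_Icc (by linarith)]
    ext q
    constructor
    · rintro ⟨⟨⟨x, y⟩, hx, hy⟩, ⟨z, hz, hzx⟩, rfl⟩
      exact (hT ⟨y, hy⟩).2 (congrArg Prod.snd hzx).symm
    · intro hq
      obtain ⟨⟨x, hx⟩, hx'⟩ := T.surjective q.1
      refine ⟨⟨(x, 0), hx, h0⟩, ⟨x, ⟨by linarith [hx.1], by linarith [hx.2]⟩, rfl⟩, ?_⟩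
      exact Prod.ext hx' (hT0.trans (Eq.symm hq))
  · rw [← Prod.image_mk_segment_right, segment_eq_Icc (by linarith)]
    ext q
    constructor
    · rintro ⟨⟨⟨x, y⟩, hx, hy⟩, ⟨z, hz, hzx⟩, rfl⟩
      exact (hT ⟨x, hx⟩).2 (congrArg Prod.fst hzx).symm
    · intro hq
      obtain ⟨⟨y, hy⟩, hy'⟩ := T.surjective q.2
      refine ⟨⟨(0, y), h0, hy⟩, ⟨y, ⟨by linarith [hy.1], by linarith [hy.2]⟩, rfl⟩, ?_⟩
      exact Prod.ext (hT0.trans (Eq.symm hq)) hy'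

/-- Five lattice points in general position whose ten connecting segments have a single crossing:
the segments between the points `1, 2` and `3, 4` cross at the origin. -/
def fivePoint : Fin 5 → ℤ × ℤ := ![(6, 6), (-6, 0), (2, 0), (0, -6), (0, 2)]

/-- The points of `fivePoint` in the real plane. -/
def fivePointReal (i : Fin 5) : ℝ × ℝ := ((fivePoint i).1, (fivePoint i).2)

theorem signedArea_fivePointReal (i j k : Fin 5) :
    signedArea (fivePointReal i) (fivePointReal j) (fivePointReal k) =
      (signedArea (fivePoint i) (fivePoint j) (fivePoint k) : ℤ) := by
  simp [signedArea, fivePointReal]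

theorem signedArea_fivePointReal_ne_zero {i j k : Fin 5} (hij : i ≠ j) (hik : i ≠ k)
    (hjk : j ≠ k) : signedArea (fivePointReal i) (fivePointReal j) (fivePointReal k) ≠ 0 := by
  rw [signedArea_fivePointReal, Int.cast_ne_zero]
  revert i j k
  unfold signedArea fivePoint
  decide

theorem fivePointReal_injective : Function.Injective fivePointReal := by
  have h : Function.Injective fivePoint := by unfold fivePoint; decide
  intro i j hij
  simp only [fivePointReal, Prod.mk.injEq, Int.cast_inj] at hij
  exact h (Prod.ext hij.1 hij.2)

theorem fivePoint_cross_cases (i j k l : Fin 5) (hij : i ≠ j) (hkl : k ≠ l) (hik : i ≠ k)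
    (hil : i ≠ l) (hjk : j ≠ k) (hjl : j ≠ l) :
    0 < signedArea (fivePoint i) (fivePoint j) (fivePoint k) *
        signedArea (fivePoint i) (fivePoint j) (fivePoint l) ∨
      0 < signedArea (fivePoint k) (fivePoint l) (fivePoint i) *
        signedArea (fivePoint k) (fivePoint l) (fivePoint j) ∨
      s(i, j) = s(1, 2) ∧ s(k, l) = s(3, 4) ∨ s(i, j) = s(3, 4) ∧ s(k, l) = s(1, 2) := by
  revert i j k l
  unfold signedArea fivePoint
  decide

/-- The segment joining two of the five points. -/
def fiveSegment (e : Sym2 (Fin 5)) : Set (ℝ × ℝ) :=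
  segment ℝ (fivePointReal e.inf) (fivePointReal e.sup)

theorem fiveSegment_mk (i j : Fin 5) :
    fiveSegment s(i, j) = segment ℝ (fivePointReal i) (fivePointReal j) := by
  rcases le_total i j with h | h
  · simp [fiveSegment, h]
  · simp [fiveSegment, h, segment_symm ℝ (fivePointReal i)]

theorem fiveSegment_one_two : fiveSegment s(1, 2) = segment ℝ (-6, 0) (2, 0) := by
  rw [fiveSegment_mk]
  simp [fivePointReal, fivePoint]

theorem fiveSegment_three_four : fiveSegment s(3, 4) = segment ℝ (0, -6) (0, 2) := by
  rw [fiveSegment_mk]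
  simp [fivePointReal, fivePoint]

theorem fiveSegment_inter_subset : fiveSegment s(1, 2) ∩ fiveSegment s(3, 4) ⊆ {(0, 0)} := by
  rw [fiveSegment_one_two, fiveSegment_three_four, ← Prod.image_mk_segment_left,
    ← Prod.image_mk_segment_right]
  rintro x ⟨⟨a, -, rfl⟩, ⟨b, -, h⟩⟩
  simp only [Prod.mk.injEq] at h
  simp [← h.1]

theorem properCross_fiveSegment :
    ProperCross (fiveSegment s(1, 2)) (fiveSegment s(3, 4)) (0, 0) := by
  rw [fiveSegment_one_two, fiveSegment_three_four]
  have := Real.pi_le_four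
  apply properCross_axes <;> linarith

theorem not_mem_fiveSegment {e : Sym2 (Fin 5)} (he : ¬ e.IsDiag) {v : Fin 5} (hv : v ∉ e) :
    fivePointReal v ∉ fiveSegment e := by
  induction e with | _ i j
  simp only [Sym2.mem_iff, not_or, Sym2.mk_isDiag_iff] at hv he
  rw [fiveSegment_mk]
  exact fun h => signedArea_fivePointReal_ne_zero he (Ne.symm hv.1) (Ne.symm hv.2)
    (signedArea_eq_zero_of_mem_segment h)

theorem fiveSegment_inter_of_mem {e₁ e₂ : Sym2 (Fin 5)} (h₁ : ¬ e₁.IsDiag) (h₂ : ¬ e₂.IsDiag)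
    (hne : e₁ ≠ e₂) {v : Fin 5} (hv₁ : v ∈ e₁) (hv₂ : v ∈ e₂) :
    fiveSegment e₁ ∩ fiveSegment e₂ ⊆ {fivePointReal v} := by
  obtain ⟨i, rfl⟩ := hv₁
  obtain ⟨j, rfl⟩ := hv₂
  simp only [Sym2.mk_isDiag_iff] at h₁ h₂
  have hij : i ≠ j := fun h => hne (by rw [h])
  rw [fiveSegment_mk, fiveSegment_mk]
  exact fun x hx => eq_of_mem_segment_of_signedArea_ne_zero
    (signedArea_fivePointReal_ne_zero h₁ h₂ hij) hx.1 hx.2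

theorem eq_of_mem_fiveSegment {e₁ e₂ : Sym2 (Fin 5)} (h₁ : ¬ e₁.IsDiag) (h₂ : ¬ e₂.IsDiag)
    (hne : e₁ ≠ e₂) {x : ℝ × ℝ} (hx₁ : x ∈ fiveSegment e₁) (hx₂ : x ∈ fiveSegment e₂)
    (hx : ∀ v, v ∈ e₁ → v ∈ e₂ → x ≠ fivePointReal v) :
    x = (0, 0) ∧ (e₁ = s(1, 2) ∧ e₂ = s(3, 4) ∨ e₁ = s(3, 4) ∧ e₂ = s(1, 2)) := by
  have hdisj : ∀ v, v ∈ e₁ → v ∉ e₂ := fun v hv₁ hv₂ =>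
    hx v hv₁ hv₂ (fiveSegment_inter_of_mem h₁ h₂ hne hv₁ hv₂ ⟨hx₁, hx₂⟩)
  suffices h : e₁ = s(1, 2) ∧ e₂ = s(3, 4) ∨ e₁ = s(3, 4) ∧ e₂ = s(1, 2) by
    refine ⟨?_, h⟩
    rcases h with ⟨rfl, rfl⟩ | ⟨rfl, rfl⟩
    · exact fiveSegment_inter_subset ⟨hx₁, hx₂⟩
    · exact fiveSegment_inter_subset ⟨hx₂, hx₁⟩
  induction e₁ with | _ i j
  induction e₂ with | _ k l
  simp only [Sym2.mk_isDiag_iff] at h₁ h₂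
  have hi := hdisj i (by simp)
  have hj := hdisj j (by simp)
  simp only [Sym2.mem_iff, not_or] at hi hj
  rw [fiveSegment_mk] at hx₁ hx₂
  rcases fivePoint_cross_cases i j k l h₁ h₂ hi.1 hi.2 hj.1 hj.2 with h | h | h
  · refine (not_mem_segment_of_signedArea_mul_pos ?_ hx₁ hx₂).elim
    rw [signedArea_fivePointReal, signedArea_fivePointReal]
    exact_mod_cast h
  · refine (not_mem_segment_of_signedArea_mul_pos ?_ hx₂ hx₁).elim
    rw [signedArea_fivePointReal, signedArea_fivePointReal]
    exact_mod_cast h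
  · exact h

/-- A graph with at most five vertices has a straight-line drawing with no crossing outside the
origin. -/
theorem exists_drawing_crossings_subset {V : Type*} (G : SimpleGraph V) (φ : V ↪ Fin 5) :
    ∃ D : Drawing G, D.crossings ⊆ {(0, 0)} := by
  have hinj := fivePointReal_injective
  have hdiag : ∀ e : G.edgeSet, ¬ ((e : Sym2 V).map φ).IsDiag := fun e => by
    rw [Sym2.isDiag_map φ.injective]
    exact G.not_isDiag_of_mem_edgeSet e.2
  have hmem : ∀ (e : Sym2 V) (v : V), φ v ∈ e.map φ ↔ v ∈ e := fun e v => by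
    simp [Sym2.mem_map, φ.injective.eq_iff]
  have hne : ∀ e₁ e₂ : G.edgeSet, e₁ ≠ e₂ → (e₁ : Sym2 V).map φ ≠ (e₂ : Sym2 V).map φ :=
    fun e₁ e₂ h h' => h (Subtype.ext (Sym2.map.injective φ.injective h'))
  have him : ∀ e : G.edgeSet, (fun t : ℝ => AffineMap.lineMap
      (fivePointReal ((e : Sym2 V).map φ).inf) (fivePointReal ((e : Sym2 V).map φ).sup) t) ''
        Icc 0 1 = fiveSegment ((e : Sym2 V).map φ) := fun e =>
    (segment_eq_image_lineMap ℝ _ _).symm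
  have hcross : ∀ e₁ e₂ : G.edgeSet, e₁ ≠ e₂ → ∀ x, x ∈ fiveSegment ((e₁ : Sym2 V).map φ) →
      x ∈ fiveSegment ((e₂ : Sym2 V).map φ) → x ∉ range (fun v => fivePointReal (φ v)) →
      x = (0, 0) ∧ ((e₁ : Sym2 V).map φ = s(1, 2) ∧ (e₂ : Sym2 V).map φ = s(3, 4) ∨
        (e₁ : Sym2 V).map φ = s(3, 4) ∧ (e₂ : Sym2 V).map φ = s(1, 2)) :=
    fun e₁ e₂ h x h₁ h₂ hx => eq_of_mem_fiveSegment (hdiag e₁) (hdiag e₂) (hne e₁ e₂ h) h₁ h₂ (by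
      intro v hv _ hxv
      obtain ⟨w, _, rfl⟩ := Sym2.mem_map.1 hv
      exact hx ⟨w, hxv.symm⟩)
  refine ⟨
    { pos := fun v => fivePointReal (φ v)
      pos_inj := hinj.comp φ.injective
      arc := fun e t => AffineMap.lineMap (fivePointReal ((e : Sym2 V).map φ).inf)
        (fivePointReal ((e : Sym2 V).map φ).sup) t
      arc_cont := fun e => AffineMap.lineMap_continuous.continuousOn
      arc_inj := fun e => by
        refine (AffineMap.lineMap_injective ℝ (hinj.ne ?_)).injOn
        have := hdiag e
        generalize (e : Sym2 V).map φ = e' at this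
        induction e' with | _ i j
        simpa using this
      arc_ends := by
        rintro ⟨⟨u, v⟩, he⟩
        rcases le_total (φ u) (φ v) with h | h
        · exact ⟨u, v, rfl, by simp [h], by simp [h]⟩
        · exact ⟨v, u, Sym2.eq_swap, by simp [h], by simp [h]⟩
      no_vertex_interior := fun e v hv => by
        rw [him]
        exact not_mem_fiveSegment (hdiag e) (by rwa [hmem])
      shared_endpoint := fun e₁ e₂ h v h₁ h₂ => by
        rw [him, him]
        exact fiveSegment_inter_of_mem (hdiag e₁) (hdiag e₂) (hne e₁ e₂ h) ((hmem _ _).2 h₁)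
          ((hmem _ _).2 h₂)
      finite_meet := fun e₁ e₂ h => by
        rw [him, him]
        refine ((finite_range fivePointReal).insert (0, 0)).subset fun x hx => ?_
        by_contra! hx'
        rw [mem_insert_iff, not_or] at hx'
        exact hx'.1 (eq_of_mem_fiveSegment (hdiag e₁) (hdiag e₂) (hne e₁ e₂ h) hx.1 hx.2
          fun v _ _ hv => hx'.2 ⟨v, hv.symm⟩).1
      proper := fun e₁ e₂ h p hp hpv => by
        rw [him, him] at hp ⊢
        obtain ⟨rfl, ⟨h₁, h₂⟩ | ⟨h₁, h₂⟩⟩ := hcross e₁ e₂ h p hp.1 hp.2 hpv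
        · rw [h₁, h₂]
          exact properCross_fiveSegment
        · rw [h₁, h₂]
          exact properCross_fiveSegment.symm
      at_most_two := fun p hp e₁ e₂ e₃ h₁ h₂ h₃ => by
        rw [him] at h₁ h₂ h₃
        by_contra! h
        have hs : (s(1, 2) : Sym2 (Fin 5)) ≠ s(3, 4) := by decide
        have h12 := (hcross e₁ e₂ h.1 p h₁ h₂ hp).2
        have h13 := (hcross e₁ e₃ h.2.1 p h₁ h₃ hp).2
        have h23 := hne _ _ h.2.2
        grind }, ?_⟩
  rintro c ⟨hc, e₁, e₂, h, h₁, h₂⟩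
  unfold Drawing.arcIm at h₁ h₂
  rw [him] at h₁ h₂
  exact (hcross e₁ e₂ h c h₁ h₂ hc).1

/-- A graph with at most five vertices is NIC-planar. -/
theorem nicPlanar_of_embedding_fin_five {V : Type*} (G : SimpleGraph V) (φ : V ↪ Fin 5) :
    G.NICPlanar := by
  obtain ⟨D, hD⟩ := exists_drawing_crossings_subset G φ
  have h : ∀ a ∈ D.crossings, ∀ b ∈ D.crossings, a = b := fun a ha b hb =>
    (hD ha).trans (hD hb).symm
  exact ⟨D, fun e a ha b hb => h a ha.1 b hb.1, fun a ha b hb hab => (hab (h a ha b hb)).elim⟩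

/-- for every positive integer `n`, the complete graph `K_n` is
NIC-planar if and only if `n ≤ 5`. -/
theorem stmt4 (n : ℕ) (hn : 0 < n) :
    (⊤ : SimpleGraph (Fin n)).NICPlanar ↔ n ≤ 5 := by
  constructor
  · intro h
    by_contra! h'
    exact not_nicPlanar_top h' h
  · exact fun h => nicPlanar_of_embedding_fin_five _ (Fin.castLEEmb h)
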